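/- arXiv:2308.16179 — 3 statements merged into one kernel-verified Lean document; each statement's English description precedes it below -/
import Mathlib

section
/- Fix (j₀,k₀) ∈ (ℤ/q)² with (j₀,k₀) ≠ (0,0). Then Σ_{(j,k) ∈ (ℤ/q)², (j,k) ≠ (0,0)} tr( C(j,k)ᴴ · C(j,k) ) = 2q³, where C(j,k) := σ^{j,k}·σ^{j₀,k₀} − σ^{j₀,k₀}·σ^{j,k} is the commutator; i.e., the sum of the squared Frobenius norms of the commutators [σ^{μ}, σ^{ν}] over all nonidentity generalized Pauli matrices σ^{μ} equals 2q³ whenever σ^{ν} is a nonidentity generalized Pauli matrix. -/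
open Matrix

/-- The generalized Pauli matrix `σ^{j,k}` with entries
`(σ^{j,k})_{a,b} = ω^{j·b}` if `a = b + k` and `0` otherwise, where `ω = exp(2πi/q)`. -/
noncomputable def genPauli (q : ℕ) (j k : ZMod q) : Matrix (ZMod q) (ZMod q) ℂ :=
  Matrix.of fun a b =>
    if a = b + k then Complex.exp (2 * Real.pi * Complex.I / q) ^ (j * b).val else 0

theorem genPauli_aux (q : ℕ) [NeZero q] (j k a b : ZMod q) :
    genPauli q j k a b = if a = b + k then ZMod.stdAddChar (j * b) else 0 := by
  simp only [genPauli, Matrix.of_apply]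
  split_ifs
  · rw [ZMod.stdAddChar_apply, ZMod.toCircle_apply, ← Complex.exp_nat_mul]
    congr 1
    ring
  · rfl

theorem genPauli_comm (q : ℕ) [NeZero q] (j k j₀ k₀ a b : ZMod q) :
    (genPauli q j k * genPauli q j₀ k₀ - genPauli q j₀ k₀ * genPauli q j k) a b =
      if a = b + k + k₀ then ZMod.stdAddChar ((j + j₀) * b) *
        (ZMod.stdAddChar (j * k₀) - ZMod.stdAddChar (j₀ * k)) else (0 : ℂ) := by
  have key : ∀ j k j₀ k₀ : ZMod q, (genPauli q j k * genPauli q j₀ k₀) a b =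
      if a = b + k₀ + k then ZMod.stdAddChar (j * (b + k₀)) * ZMod.stdAddChar (j₀ * b)
        else (0 : ℂ) := by
    intro j k j₀ k₀
    rw [Matrix.mul_apply, Finset.sum_eq_single (b + k₀)]
    · simp only [genPauli_aux, if_true, ite_mul, zero_mul]
    · intro c _ hc
      simp [genPauli_aux, hc]
    · simp
  rw [Matrix.sub_apply, key, key, add_right_comm b k₀ k]
  split_ifs
  · simp only [mul_add, add_mul, AddChar.map_add_eq_mul]
    ring
  · simp

theorem genPauli_tr (q : ℕ) [NeZero q] (j k j₀ k₀ : ZMod q) :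
    Matrix.trace
      ((genPauli q j k * genPauli q j₀ k₀ - genPauli q j₀ k₀ * genPauli q j k)ᴴ *
        (genPauli q j k * genPauli q j₀ k₀ - genPauli q j₀ k₀ * genPauli q j k)) =
    (q : ℂ) * (2 - ZMod.stdAddChar (j * k₀) * ZMod.stdAddChar (k * (-j₀))
      - ZMod.stdAddChar (j * (-k₀)) * ZMod.stdAddChar (k * j₀)) := by
  have h1 : ∀ x : ZMod q, (starRingEnd ℂ) (ZMod.stdAddChar x) = ZMod.stdAddChar (-x) :=
    fun x => (AddChar.map_neg_eq_conj _ _).symm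
  have h2 : ∀ x : ZMod q, (ZMod.stdAddChar (-x) : ℂ) * ZMod.stdAddChar x = 1 := by
    intro x
    rw [← AddChar.map_add_eq_mul]; simp
  have h3 : ∀ b : ZMod q,
      ((genPauli q j k * genPauli q j₀ k₀ - genPauli q j₀ k₀ * genPauli q j k)ᴴ *
        (genPauli q j k * genPauli q j₀ k₀ - genPauli q j₀ k₀ * genPauli q j k)) b b =
      (2 - ZMod.stdAddChar (j * k₀) * ZMod.stdAddChar (k * (-j₀))
      - ZMod.stdAddChar (j * (-k₀)) * ZMod.stdAddChar (k * j₀) : ℂ) := by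
    intro b
    rw [Matrix.mul_apply, Finset.sum_eq_single (b + k + k₀)]
    · rw [Matrix.conjTranspose_apply, genPauli_comm, if_pos rfl]
      simp only [← starRingEnd_apply, map_mul, map_sub, h1]
      have e1 := h2 ((j + j₀) * b)
      have e2 := h2 (j * k₀)
      have e3 := h2 (j₀ * k)
      rw [mul_neg, mul_neg, mul_comm k j₀]
      linear_combination (ZMod.stdAddChar (-(j * k₀)) - ZMod.stdAddChar (-(j₀ * k))) * (ZMod.stdAddChar (j * k₀) - ZMod.stdAddChar (j₀ * k)) * e1 + e2 + e3
    · intro c _ hc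
      rw [genPauli_comm, if_neg hc, mul_zero]
    · simp
  simp only [Matrix.trace, Matrix.diag_apply, h3]
  simp [ZMod.card]
  ring

theorem genPauli_sum (q : ℕ) [NeZero q] (u v : ZMod q) (h : u ≠ 0 ∨ v ≠ 0) :
    ∑ p : ZMod q × ZMod q, (ZMod.stdAddChar (p.1 * u) * ZMod.stdAddChar (p.2 * v) : ℂ) = 0 := by
  rw [Fintype.sum_prod_type]
  simp only [← Finset.mul_sum, ← Finset.sum_mul]
  have hp := ZMod.isPrimitive_stdAddChar q
  rw [AddChar.sum_mulShift u hp, AddChar.sum_mulShift v hp]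
  rcases h with h | h <;> simp [h]

theorem stmt9 (q : ℕ) [NeZero q] (hq : 2 ≤ q) (j₀ k₀ : ZMod q)
    (h₀ : (j₀, k₀) ≠ (0, 0)) :
    ∑ p ∈ (Finset.univ : Finset (ZMod q × ZMod q)) \ {(0, 0)},
        Matrix.trace
          ((genPauli q p.1 p.2 * genPauli q j₀ k₀ - genPauli q j₀ k₀ * genPauli q p.1 p.2)ᴴ *
            (genPauli q p.1 p.2 * genPauli q j₀ k₀ - genPauli q j₀ k₀ * genPauli q p.1 p.2)) =
      (2 * (q : ℂ) ^ 3) := by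
  have h : j₀ ≠ 0 ∨ k₀ ≠ 0 := by
    by_contra! hc
    exact h₀ (by rw [hc.1, hc.2])
  simp only [genPauli_tr]
  rw [Finset.sum_sdiff_eq_sub (Finset.subset_univ _), Finset.sum_singleton, ← Finset.mul_sum,
    Finset.sum_sub_distrib, Finset.sum_sub_distrib, genPauli_sum q k₀ (-j₀) (by simpa using h.symm),
    genPauli_sum q (-k₀) j₀ (by simpa using h.symm)]
  simp [ZMod.card]
  ring
end

section
/- Fix a rational number q > 0 and an integer w ≥ 1. Index binary strings i = (i₁,…,i_w) ∈ {0,1}^w with the convention i₀ = 0. Define m(a,b,c) ∈ ℚ for a,b,c ∈ {0,1} by: m(a,b,c) = q/(q²+1) if a ≠ b; m(a,b,c) = 1 if a = b = c; m(a,b,c) = 0 if a = b ≠ c. Define the 2^w × 2^w matrix T over ℚ, with rows and columns indexed by {0,1}^w, by T(i,j) = ( ∏_{k=1}^{w} m(i_{k−1}, j_k, i_k) ) · q^{i_w}. For n ∈ {0,…,w} set ε_n = (q/(q²+1))^n if n is even and ε_n = q·(q/(q²+1))^n if n is odd. Then the characteristic polynomial of T equals ∏_{n=0}^{w} (X − ε_n)^{binom(w,n)};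 in particular, every eigenvalue of T is of the form ε_n and has algebraic multiplicity binom(w,n). -/
open Matrix Polynomial

/-- `m(a,b,c)`: equals `q/(q²+1)` if `a ≠ b`, `1` if `a = b = c`, `0` if `a = b ≠ c`. -/
def mval (q : ℚ) (a b c : Fin 2) : ℚ :=
  if a ≠ b then q / (q ^ 2 + 1) else if a = c then 1 else 0

/-- The entry `i_{k-1}` of a binary string `i = (i₁,…,i_w)`, with the convention `i₀ = 0`. -/
def prevEntry {w : ℕ} (i : Fin w → Fin 2) (k : Fin w) : Fin 2 :=
  if (k : ℕ) = 0 then 0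
  else i ⟨(k : ℕ) - 1, lt_of_le_of_lt (Nat.sub_le _ _) k.isLt⟩

/-- The ensemble-averaged light-like generator of the spatially-temporally random
Haar-random model: `T(i,j) = (∏_{k=1}^w m(i_{k−1}, j_k, i_k)) · q^{i_w}` with `i₀ = 0`. -/
def Thrm (q : ℚ) (w : ℕ) (hw : 1 ≤ w) :
    Matrix (Fin w → Fin 2) (Fin w → Fin 2) ℚ :=
  Matrix.of fun i j =>
    (∏ k : Fin w, mval q (prevEntry i k) (j k) (i k)) *
      q ^ ((i ⟨w - 1, by omega⟩ : ℕ))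

/-- `ε_n = (q/(q²+1))^n` for even `n` and `ε_n = q·(q/(q²+1))^n` for odd `n`. -/
def eps (q : ℚ) (n : ℕ) : ℚ :=
  if Even n then (q / (q ^ 2 + 1)) ^ n else q * (q / (q ^ 2 + 1)) ^ n

def dwall {w : ℕ} (i : Fin w → Fin 2) : Lex (Fin w → Bool) :=
  toLex fun k => decide (prevEntry i k ≠ i k)

lemma dwall_apply {w : ℕ} (i : Fin w → Fin 2) (k : Fin w) :
    ofLex (dwall i) k = decide (prevEntry i k ≠ i k) := rfl

lemma prev_congr {w : ℕ} (i j : Fin w → Fin 2) (k : Fin w)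
    (h : ∀ l < k, i l = j l) : prevEntry i k = prevEntry j k := by
  unfold prevEntry
  split_ifs with h0
  · rfl
  · apply h
    rw [Fin.lt_def]
    show (k : ℕ) - 1 < k
    omega

lemma fin2_aux (a b c : Fin 2) (h : decide (a ≠ b) = decide (a ≠ c)) : b = c := by
  revert a b c; decide

lemma agree_below {w : ℕ} (i j : Fin w → Fin 2) (n : ℕ)
    (h : ∀ l : Fin w, (l : ℕ) < n → ofLex (dwall i) l = ofLex (dwall j) l) :
    ∀ l : Fin w, (l : ℕ) < n → i l = j l := by
  intro l
  induction l using WellFoundedLT.induction with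
  | ind l ih =>
    intro hl
    have hp := prev_congr i j l (fun m hm => ih m hm (lt_trans (Fin.lt_def.1 hm) hl))
    have := h l hl
    rw [dwall_apply, dwall_apply, hp] at this
    exact fin2_aux _ _ _ this

lemma dwall_inj (w : ℕ) : Function.Injective (dwall (w := w)) := by
  intro i j h
  funext l
  exact agree_below i j w (fun l _ => by rw [h]) l l.isLt

lemma dwall_bij (w : ℕ) : Function.Bijective (dwall (w := w)) := by
  rw [Fintype.bijective_iff_injective_and_card]
  refine ⟨dwall_inj w, ?_⟩
  rw [Fintype.card_lex]
  simp

def wset {w : ℕ} (i : Fin w → Fin 2) : Finset (Fin w) :=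
  Finset.univ.filter fun k => prevEntry i k ≠ i k

lemma wset_bij (w : ℕ) : Function.Bijective (wset (w := w)) := by
  rw [Fintype.bijective_iff_injective_and_card]
  refine ⟨?_, by simp⟩
  intro i j h
  apply dwall_inj w
  apply ofLex.injective
  funext k
  rw [dwall_apply, dwall_apply, decide_eq_decide]
  have := Finset.ext_iff.1 h k
  simpa [wset] using this

lemma T_zero (q : ℚ) (w : ℕ) (hw : 1 ≤ w) (i j : Fin w → Fin 2)
    (h : dwall j < dwall i) : Thrm q w hw i j = 0 := by
  obtain ⟨k, hk, hlt⟩ := h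
  have hag := agree_below j i k (fun l hl => hk l hl)
  have hp := prev_congr j i k (fun l hl => hag l hl)
  change decide (prevEntry j k ≠ j k) < decide (prevEntry i k ≠ i k) at hlt
  rw [Bool.lt_iff] at hlt
  simp only [decide_eq_false_iff_not, decide_eq_true_eq, not_not] at hlt
  unfold Thrm
  rw [Matrix.of_apply, Finset.prod_eq_zero (Finset.mem_univ k), zero_mul]
  unfold mval
  rw [if_neg, if_neg hlt.2]
  rw [← hp, hlt.1]; simp

lemma parity (w : ℕ) (i : Fin (w + 1) → Fin 2) :
    (∑ k, if prevEntry i k ≠ i k then 1 else 0 : ℕ) % 2 = (i (Fin.last w) : ℕ) := by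
  induction w with
  | zero =>
    have h0 : prevEntry i (Fin.last 0) = 0 := rfl
    have h1 : (∑ k, if prevEntry i k ≠ i k then 1 else 0 : ℕ)
        = if prevEntry i (Fin.last 0) ≠ i (Fin.last 0) then 1 else 0 :=
      Fin.sum_univ_one _
    rw [h1, h0]
    generalize i (Fin.last 0) = a
    revert a; decide
  | succ w ih =>
    rw [Fin.sum_univ_castSucc]
    have h1 := ih (fun k => i k.castSucc)
    have h2 : ∀ k : Fin (w + 1), prevEntry (fun k => i k.castSucc) k
        = prevEntry i k.castSucc := by
      intro k
      simp only [prevEntry, Fin.val_castSucc]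
      rfl
    simp only [h2] at h1
    have h3 : prevEntry i (Fin.last (w + 1)) = i (Fin.last w).castSucc := by
      simp only [prevEntry, Fin.val_last]
      rw [if_neg (by omega)]
      rfl
    rw [h3, Nat.add_mod, h1]
    generalize i (Fin.last w).castSucc = a
    generalize i (Fin.last (w + 1)) = b
    revert a b; decide

lemma prod_powerset_card' {α β : Type*} [CommMonoid α] (f : ℕ → α) (x : Finset β) :
    ∏ m ∈ x.powerset, f m.card = ∏ m ∈ Finset.range (x.card + 1), f m ^ (x.card.choose m) :=
  Finset.sum_powerset_apply_card (α := Additive α) f (x := x)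

lemma T_diag (q : ℚ) (w : ℕ) (hw : 1 ≤ w) (i : Fin w → Fin 2) :
    Thrm q w hw i i = eps q (wset i).card := by
  obtain ⟨w, rfl⟩ : ∃ v, w = v + 1 := ⟨w - 1, by omega⟩
  have hp := parity w i
  rw [← Finset.card_filter] at hp
  change (wset i).card % 2 = _ at hp
  have h1 : ∏ k, mval q (prevEntry i k) (i k) (i k)
      = (q / (q ^ 2 + 1)) ^ (wset i).card := by
    rw [wset, ← Finset.prod_const, Finset.prod_filter]
    apply Finset.prod_congr rfl
    intro k _
    unfold mval
    by_cases h : prevEntry i k = i k <;> simp [h]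
  unfold Thrm
  rw [Matrix.of_apply, h1]
  have h2 : (⟨w + 1 - 1, by omega⟩ : Fin (w + 1)) = Fin.last w := rfl
  rw [h2, ← hp]
  unfold eps
  split_ifs with h
  · rw [Nat.even_iff.1 h]; simp
  · rw [Nat.not_even_iff.1 h]; ring

theorem stmt15 (q : ℚ) (hq : 0 < q) (w : ℕ) (hw : 1 ≤ w) :
    Matrix.charpoly (Thrm q w hw) =
      ∏ n ∈ Finset.range (w + 1), (X - C (eps q n)) ^ (w.choose n) := by
  let e := Equiv.ofBijective _ (dwall_bij w)
  have htri : (Matrix.reindex e e (Thrm q w hw)).BlockTriangular id := by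
    intro a b hab
    rw [Matrix.reindex_apply, Matrix.submatrix_apply]
    apply T_zero
    have ha : dwall (e.symm a) = a := e.apply_symm_apply a
    have hb : dwall (e.symm b) = b := e.apply_symm_apply b
    rw [ha, hb]; exact hab
  rw [← Matrix.charpoly_reindex e, Matrix.charpoly_of_isUpperTriangular _ htri]
  have h1 : ∏ a, (X - C (Matrix.reindex e e (Thrm q w hw) a a))
      = ∏ i : Fin w → Fin 2, (X - C (eps q (wset i).card)) := by
    rw [← Equiv.prod_comp e]
    apply Finset.prod_congr rfl
    intro i _
    rw [Matrix.reindex_apply, Matrix.submatrix_apply, e.symm_apply_apply, T_diag]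
  rw [h1, Function.Bijective.prod_comp (wset_bij w) (fun s => X - C (eps q s.card)),
    ← Finset.powerset_univ, prod_powerset_card' (fun n => X - C (eps q n))]
  simp
end

section
/- Fix a real number q ≥ 1 and an integer w ≥ 1, and let T be the (w+1)×(w+1) real matrix with rows and columns indexed by {0,…,w} and entries T_{j+1,j} = q for 0 ≤ j ≤ w−2, T_{w,w−1} = √(q²−1), T_{w,w} = 1, and all other entries 0. Then the ℓ²→ℓ² operator norm of T equals q. -/
open Matrix

/-- The ℓ²→ℓ² operator norm of a real square matrix. -/
noncomputable def l2OpNormR {n : ℕ} (A : Matrix (Fin n) (Fin n) ℝ) : ℝ :=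
  ‖Matrix.toEuclideanCLM (𝕜 := ℝ) A‖

/-- The light-like generator of a completely localized brick-wall circuit, restricted to its
invariant subspace: `T_{j+1,j} = q` for `0 ≤ j ≤ w−2`, `T_{w,w−1} = √(q²−1)`, `T_{w,w} = 1`,
and all other entries `0`. -/
noncomputable def locT (q : ℝ) (w : ℕ) : Matrix (Fin (w + 1)) (Fin (w + 1)) ℝ :=
  Matrix.of fun i j =>
    if (i : ℕ) = (j : ℕ) + 1 ∧ (j : ℕ) + 2 ≤ w then q
    else if (i : ℕ) = w ∧ (j : ℕ) + 1 = w then Real.sqrt (q ^ 2 - 1)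
    else if (i : ℕ) = w ∧ (j : ℕ) = w then 1
    else 0

lemma locT_aux (q : ℝ) (hq : 1 ≤ q) (v : ℕ) :
    locT q (v+1) * (locT q (v+1))ᴴ = diagonal (fun i => if i = 0 then 0 else q ^ 2) := by
  have hs : Real.sqrt (q ^ 2 - 1) * Real.sqrt (q ^ 2 - 1) = q ^ 2 - 1 :=
    Real.mul_self_sqrt (by nlinarith)
  have h0 : ∀ k, locT q (v+1) 0 k = 0 := by
    intro k
    simp [locT]
  have h1 : ∀ (i k : Fin (v+1)), locT q (v+1) i.succ k.castSucc =
      if k = i then (if (i : ℕ) + 1 ≤ v then q else Real.sqrt (q ^ 2 - 1)) else 0 := by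
    intro i k
    have := i.2
    have := k.2
    simp only [locT, Matrix.of_apply, Fin.val_succ, Fin.val_castSucc, Fin.ext_iff]
    split_ifs <;> first | rfl | omega
  have h2 : ∀ (i : Fin (v+1)), locT q (v+1) i.succ (Fin.last (v+1)) =
      if (i : ℕ) = v then 1 else 0 := by
    intro i
    have := i.2
    simp only [locT, Matrix.of_apply, Fin.val_succ, Fin.val_last, and_true]
    split_ifs <;> first | rfl | omega
  ext i l
  rw [Matrix.mul_apply]
  simp only [conjTranspose_apply, star_trivial]
  refine Fin.cases ?_ (fun i => ?_) i
  · simp [h0, diagonal_apply]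
  refine Fin.cases ?_ (fun l => ?_) l
  · simp [h0, diagonal_apply]
  rw [Fin.sum_univ_castSucc]
  simp only [h1, h2, ite_mul, zero_mul, Finset.sum_ite_eq', Finset.sum_ite_eq, Finset.mem_univ,
    if_true, diagonal_apply, Fin.succ_inj, Fin.succ_ne_zero, if_false]
  have := i.2
  have := l.2
  by_cases hil : i = l
  · subst hil
    by_cases hi : (i : ℕ) = v
    · simp [hi, hs]
    · have : (i : ℕ) + 1 ≤ v := by omega
      simp [hi, this, pow_two]
  · have hne : (i : ℕ) ≠ l := fun h => hil (Fin.ext h)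
    simp only [hil, if_false]
    split_ifs <;> first | omega | simp

theorem stmt18 (q : ℝ) (hq : 1 ≤ q) (w : ℕ) (hw : 1 ≤ w) :
    l2OpNormR (locT q w) = q := by
  obtain ⟨v, rfl⟩ : ∃ v, w = v + 1 := ⟨w - 1, by omega⟩
  have h := Matrix.l2_opNorm_conjTranspose_mul_self ((locT q (v+1))ᴴ)
  rw [conjTranspose_conjTranspose, locT_aux q hq v, Matrix.l2_opNorm_diagonal,
    Matrix.l2_opNorm_conjTranspose] at h
  have hn : ‖(fun i : Fin (v+1+1) => if i = 0 then (0:ℝ) else q ^ 2)‖ = q ^ 2 := by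
    apply le_antisymm
    · refine (pi_norm_le_iff_of_nonneg (by positivity)).2 fun i => ?_
      split_ifs
      · simp; positivity
      · simp
    · have := norm_le_pi_norm (fun i : Fin (v+1+1) => if i = 0 then (0:ℝ) else q ^ 2) 1
      simpa using this
  rw [hn, ← pow_two, ← Matrix.l2_opNorm_toEuclideanCLM] at h
  exact ((pow_left_inj₀ (by linarith) (norm_nonneg _) two_ne_zero).1 h).symm
end
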